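/- arXiv:2501.18679 — 3 statements merged into one kernel-verified Lean document; each statement's English description precedes it below -/
import Mathlib

section
/- (α = 2 instance of Theorem 2's chain E_A^{(α)}(O_U) ≤ ν(U).) Let N = N_A + N_B, let U be a unitary matrix on (Fin N → Fin 2), let a₀ : Fin N → Fin 4, and set O_U := Uᴴ * P_{a₀} * U. Then Re tr(ρ_A(O_U)²) ≥ (card (Stab U)) / 4^N; equivalently, the Rényi-2 local-operator entanglement of O_U across the bipartition is at most the unitary nullity ν(U) = 2N − log₂ (card (Stab U)). -/
open Matrix Kronecker
open scoped Classical

noncomputable section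

/-- Single-qubit Pauli matrices. -/
def pauli : Fin 4 → Matrix (Fin 2) (Fin 2) ℂ :=
  ![1, !![0, 1; 1, 0], !![0, -Complex.I; Complex.I, 0], !![1, 0; 0, -1]]

/-- Pauli string on `N` qubits with label `a`. -/
def PauliString {N : ℕ} (a : Fin N → Fin 4) :
    Matrix (Fin N → Fin 2) (Fin N → Fin 2) ℂ :=
  fun f g => ∏ k, pauli (a k) (f k) (g k)

/-- Reduced Choi state: partial trace over the doubled-B factor of the
normalized Choi state of `O`. -/
def rhoA {ιA ιB : Type*} [Fintype ιA] [Fintype ιB]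
    (O : Matrix (ιA × ιB) (ιA × ιB) ℂ) :
    Matrix (ιA × ιA) (ιA × ιA) ℂ :=
  fun p q =>
    (1 / (Fintype.card ιA * Fintype.card ιB : ℂ)) *
      ∑ b : ιB, ∑ b' : ιB, O (p.1, b) (p.2, b') * star (O (q.1, b) (q.2, b'))

/-- Identification of `N = N_A + N_B` qubits with the pair of subsystems. -/
def qubitEquiv (NA NB : ℕ) :
    (Fin (NA + NB) → Fin 2) ≃ (Fin NA → Fin 2) × (Fin NB → Fin 2) :=
  (Equiv.arrowCongr finSumFinEquiv.symm (Equiv.refl (Fin 2))).trans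
    (Equiv.sumArrowEquivProdArrow _ _ _)

/-- Reduced Choi state of an `N = N_A + N_B` qubit operator, subsystem A
being the first `N_A` qubits. -/
def rhoAq (NA NB : ℕ)
    (O : Matrix (Fin (NA + NB) → Fin 2) (Fin (NA + NB) → Fin 2) ℂ) :
    Matrix ((Fin NA → Fin 2) × (Fin NA → Fin 2))
      ((Fin NA → Fin 2) × (Fin NA → Fin 2)) ℂ :=
  rhoA (Matrix.reindex (qubitEquiv NA NB) (qubitEquiv NA NB) O)

/-- `n`-fold replica (tensor power) of a matrix. -/
def replica {ι : Type*} (n : ℕ) (O : Matrix ι ι ℂ) :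
    Matrix (Fin n → ι) (Fin n → ι) ℂ :=
  fun f g => ∏ a, O (f a) (g a)

/-- Replica permutation operator. -/
def Tperm {ι : Type*} [DecidableEq ι] {n : ℕ} (π : Equiv.Perm (Fin n)) :
    Matrix (Fin n → ι) (Fin n → ι) ℂ :=
  fun f g => if f = g ∘ π then 1 else 0

/-- Number of cycles of a permutation, counting fixed points as 1-cycles. -/
def numCycles {n : ℕ} (π : Equiv.Perm (Fin n)) : ℕ :=
  Multiset.card π.cycleType + (Finset.univ.filter fun x => π x = x).card

/-- `δ(π) = 0` if `π` has no fixed points and all cycles of even length,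
else `δ(π) = 1`. -/
def deltaOdd {n : ℕ} (π : Equiv.Perm (Fin n)) : ℕ :=
  if (∀ x, π x ≠ x) ∧ (∀ c ∈ π.cycleType, Even c) then 0 else 1

/-- Projector onto four-fold replicated Pauli strings. -/
def LambdaPlus (N : ℕ) :
    Matrix (Fin 4 → (Fin N → Fin 2)) (Fin 4 → (Fin N → Fin 2)) ℂ :=
  (1 / (4 ^ N : ℂ)) • ∑ a : Fin N → Fin 4, replica 4 (PauliString a)

def permA : Equiv.Perm (Fin 4) := Equiv.swap 0 1 * Equiv.swap 2 3
def permB : Equiv.Perm (Fin 4) := Equiv.swap 0 3 * Equiv.swap 1 2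

/-- The purity contraction permutation operator `T'` on four replicas of a
bipartite system. -/
def Tprime {ιA ιB : Type*} [DecidableEq ιA] [DecidableEq ιB] :
    Matrix (Fin 4 → ιA × ιB) (Fin 4 → ιA × ιB) ℂ :=
  fun f g =>
    if (∀ a, (f a).1 = (g (permA a)).1 ∧ (f a).2 = (g (permB a)).2) then 1 else 0

/-- The unitary stabilizer group of `U` (as a finite set of pairs of Pauli
labels). -/
def Stab {N : ℕ} (U : Matrix (Fin N → Fin 2) (Fin N → Fin 2) ℂ) :
    Finset ((Fin N → Fin 4) × (Fin N → Fin 4)) :=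
  Finset.univ.filter fun p =>
    Matrix.trace (PauliString p.1 * Uᴴ * PauliString p.2 * U) / (2 ^ N : ℂ)
      ∈ ({1, -1} : Set ℂ)


/-- The `N`-fold tensor product of single-qubit matrices. -/
def qubitTensor {N : ℕ} (A : Fin N → Matrix (Fin 2) (Fin 2) ℂ) :
    Matrix (Fin N → Fin 2) (Fin N → Fin 2) ℂ :=
  fun f g => ∏ k, A k (f k) (g k)

theorem PauliString_eq_qubitTensor {N : ℕ} (a : Fin N → Fin 4) :
    PauliString a = qubitTensor fun k => pauli (a k) := rfl

theorem qubitTensor_mul {N : ℕ} (A B : Fin N → Matrix (Fin 2) (Fin 2) ℂ) :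
    qubitTensor A * qubitTensor B = qubitTensor fun k => A k * B k := by
  ext f g
  simp only [qubitTensor, Matrix.mul_apply, ← Finset.prod_mul_distrib]
  rw [Finset.prod_univ_sum, Fintype.piFinset_univ]

theorem trace_qubitTensor {N : ℕ} (A : Fin N → Matrix (Fin 2) (Fin 2) ℂ) :
    (qubitTensor A).trace = ∏ k, (A k).trace := by
  simp only [qubitTensor, Matrix.trace, Matrix.diag_apply]
  rw [Finset.prod_univ_sum, Fintype.piFinset_univ]

theorem qubitTensor_one {N : ℕ} :
    qubitTensor (fun _ : Fin N => (1 : Matrix (Fin 2) (Fin 2) ℂ)) = 1 := by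
  ext f g
  simp only [qubitTensor, Matrix.one_apply, Finset.prod_ite_zero, funext_iff]
  simp

theorem qubitTensor_smul {N : ℕ} (c : Fin N → ℂ) (A : Fin N → Matrix (Fin 2) (Fin 2) ℂ) :
    qubitTensor (fun k => c k • A k) = (∏ k, c k) • qubitTensor A := by
  ext f g
  simp [qubitTensor, Finset.prod_mul_distrib]

theorem conjTranspose_qubitTensor {N : ℕ} (A : Fin N → Matrix (Fin 2) (Fin 2) ℂ) :
    (qubitTensor A)ᴴ = qubitTensor fun k => (A k)ᴴ := by
  ext f g
  simp [qubitTensor, Matrix.conjTranspose_apply]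

theorem conjTranspose_pauli (a : Fin 4) : (pauli a)ᴴ = pauli a := by
  ext i j
  fin_cases a <;> fin_cases i <;> fin_cases j <;> simp [pauli]

theorem pauli_mul_self (a : Fin 4) : pauli a * pauli a = 1 := by
  ext i j
  fin_cases a <;> fin_cases i <;> fin_cases j <;> simp [pauli, Matrix.mul_apply]

/-- The sign `±1` recording whether two single-qubit Pauli matrices commute or anticommute. -/
def pauliSign (a b : Fin 4) : ℝ := if a = 0 ∨ b = 0 ∨ a = b then 1 else -1

theorem pauli_conj (a b : Fin 4) :
    pauli a * pauli b * pauli a = (pauliSign a b : ℂ) • pauli b := by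
  ext i j
  fin_cases a <;> fin_cases b <;> fin_cases i <;> fin_cases j <;>
    simp [pauli, Matrix.mul_apply, pauliSign]

theorem trace_pauli_mul (a b : Fin 4) :
    (pauli a * pauli b).trace = if a = b then 2 else 0 := by
  fin_cases a <;> fin_cases b <;>
    simp [pauli, Matrix.trace] <;> norm_num

theorem sum_star_pauli_mul (i j k l : Fin 2) :
    ∑ a, star (pauli a i j) * pauli a k l = if i = k ∧ j = l then 2 else 0 := by
  fin_cases i <;> fin_cases j <;> fin_cases k <;> fin_cases l <;>
    simp [pauli, Fin.sum_univ_four] <;> norm_num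

theorem sum_pauliSign_mul (a b : Fin 4) :
    ∑ c, pauliSign a c * pauliSign b c = if a = b then 4 else 0 := by
  fin_cases a <;> fin_cases b <;>
    simp [pauliSign, Fin.sum_univ_four] <;> norm_num

/-- The sign `±1` recording whether two Pauli strings commute or anticommute. -/
def stringSign {N : ℕ} (a b : Fin N → Fin 4) : ℝ := ∏ k, pauliSign (a k) (b k)

theorem stringSign_mul_self {N : ℕ} (a b : Fin N → Fin 4) :
    stringSign a b * stringSign a b = 1 := by
  rw [stringSign, ← Finset.prod_mul_distrib]
  refine Finset.prod_eq_one fun k _ => ?_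
  unfold pauliSign
  split_ifs <;> norm_num

theorem sum_stringSign_mul {N : ℕ} (a b : Fin N → Fin 4) :
    ∑ c, stringSign a c * stringSign b c = if a = b then 4 ^ N else 0 := by
  simp only [stringSign, ← Finset.prod_mul_distrib]
  have h := Finset.prod_univ_sum (fun _ : Fin N => (Finset.univ : Finset (Fin 4)))
    fun k c => pauliSign (a k) c * pauliSign (b k) c
  rw [Fintype.piFinset_univ] at h
  rw [← h]
  simp only [sum_pauliSign_mul, Finset.prod_ite_zero, funext_iff]
  simp

theorem conjTranspose_PauliString {N : ℕ} (a : Fin N → Fin 4) :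
    (PauliString a)ᴴ = PauliString a := by
  simp [PauliString_eq_qubitTensor, conjTranspose_qubitTensor, conjTranspose_pauli]

theorem PauliString_mul_self {N : ℕ} (a : Fin N → Fin 4) :
    PauliString a * PauliString a = 1 := by
  simp [PauliString_eq_qubitTensor, qubitTensor_mul, pauli_mul_self, qubitTensor_one]

theorem PauliString_conj {N : ℕ} (a b : Fin N → Fin 4) :
    PauliString a * PauliString b * PauliString a =
      (stringSign a b : ℂ) • PauliString b := by
  simp only [PauliString_eq_qubitTensor, qubitTensor_mul, pauli_conj, qubitTensor_smul, stringSign,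
    Complex.ofReal_prod]

theorem trace_PauliString_mul {N : ℕ} (a b : Fin N → Fin 4) :
    (PauliString a * PauliString b).trace = if a = b then 2 ^ N else 0 := by
  simp only [PauliString_eq_qubitTensor, qubitTensor_mul, trace_qubitTensor, trace_pauli_mul,
    Finset.prod_ite_zero, funext_iff]
  simp

theorem sum_star_PauliString_mul {N : ℕ} (f g f' g' : Fin N → Fin 2) :
    ∑ a, star (PauliString a f g) * PauliString a f' g' =
      if f = f' ∧ g = g' then 2 ^ N else 0 := by
  simp only [PauliString, star_prod, ← Finset.prod_mul_distrib]
  have h := Finset.prod_univ_sum (fun _ : Fin N => (Finset.univ : Finset (Fin 4)))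
    fun k c => star (pauli c (f k) (g k)) * pauli c (f' k) (g' k)
  rw [Fintype.piFinset_univ] at h
  rw [← h]
  simp only [sum_star_pauli_mul, Finset.prod_ite_zero, funext_iff, ← forall_and]
  simp

/-- The vectorized Pauli strings as the rows of a matrix. -/
def pauliBasis (N : ℕ) :
    Matrix (Fin N → Fin 4) ((Fin N → Fin 2) × (Fin N → Fin 2)) ℂ :=
  fun a p => PauliString a p.2 p.1

theorem conjTranspose_pauliBasis_mul (N : ℕ) :
    (pauliBasis N)ᴴ * pauliBasis N = (2 ^ N : ℂ) • 1 := by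
  ext p q
  simp only [Matrix.mul_apply, Matrix.conjTranspose_apply, pauliBasis, sum_star_PauliString_mul]
  simp [Matrix.one_apply, Prod.ext_iff, and_comm]

open scoped ComplexOrder in
/-- Hermitian involutions with normalized overlap `±1` agree up to sign. -/
theorem eq_or_eq_neg_of_trace_mul {ι : Type*} [Fintype ι] [DecidableEq ι]
    {A B : Matrix ι ι ℂ}
    (hA : Aᴴ = A) (hB : Bᴴ = B) (hA' : A * A = 1) (hB' : B * B = 1)
    (h : (A * B).trace = Fintype.card ι ∨ (A * B).trace = -Fintype.card ι) :
    B = A ∨ B = -A := by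
  have hBA : (B * A).trace = (A * B).trace := Matrix.trace_mul_comm _ _
  rcases h with h | h
  · left
    rw [← sub_eq_zero, ← Matrix.trace_conjTranspose_mul_self_eq_zero_iff]
    simp [hA, hB, sub_mul, mul_sub, hA', hB', hBA, h]
  · right
    rw [← sub_eq_zero, ← Matrix.trace_conjTranspose_mul_self_eq_zero_iff]
    simp [hA, hB, add_mul, mul_add, hA', hB', hBA, h]

theorem conj_PauliString_of_mem_Stab {N : ℕ} {U : Matrix (Fin N → Fin 2) (Fin N → Fin 2) ℂ}
    (hU : U ∈ Matrix.unitaryGroup (Fin N → Fin 2) ℂ) {p : (Fin N → Fin 4) × (Fin N → Fin 4)}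
    (hp : p ∈ Stab U) :
    Uᴴ * PauliString p.2 * U = PauliString p.1 ∨
      Uᴴ * PauliString p.2 * U = -PauliString p.1 := by
  have hU' : U * Uᴴ = 1 := Matrix.mem_unitaryGroup_iff.mp hU
  have hU'' : Uᴴ * U = 1 := Matrix.mem_unitaryGroup_iff'.mp hU
  refine eq_or_eq_neg_of_trace_mul (conjTranspose_PauliString _) ?_ (PauliString_mul_self _) ?_ ?_
  · simp [Matrix.conjTranspose_mul, conjTranspose_PauliString, mul_assoc]
  · calc Uᴴ * PauliString p.2 * U * (Uᴴ * PauliString p.2 * U)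
        = Uᴴ * PauliString p.2 * (U * Uᴴ) * PauliString p.2 * U := by noncomm_ring
      _ = Uᴴ * (PauliString p.2 * PauliString p.2) * U := by rw [hU']; noncomm_ring
      _ = 1 := by rw [PauliString_mul_self, mul_one, hU'']
  · have h := (Finset.mem_filter.mp hp).2
    have hD : (2 ^ N : ℂ) ≠ 0 := pow_ne_zero _ two_ne_zero
    simp only [Set.mem_insert_iff, Set.mem_singleton_iff, div_eq_iff hD] at h
    simpa [mul_assoc] using h

theorem injOn_fst_Stab {N : ℕ} {U : Matrix (Fin N → Fin 2) (Fin N → Fin 2) ℂ}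
    (hU : U ∈ Matrix.unitaryGroup (Fin N → Fin 2) ℂ) {p q : (Fin N → Fin 4) × (Fin N → Fin 4)}
    (hp : p ∈ Stab U) (hq : q ∈ Stab U) (h : p.1 = q.1) : p = q := by
  have hU' : U * Uᴴ = 1 := Matrix.mem_unitaryGroup_iff.mp hU
  refine Prod.ext h ?_
  by_contra hne
  have key : ∀ b : Fin N → Fin 4, U * (Uᴴ * PauliString b * U) * Uᴴ = PauliString b := fun b => by
    calc U * (Uᴴ * PauliString b * U) * Uᴴ = (U * Uᴴ) * PauliString b * (U * Uᴴ) := by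
          noncomm_ring
      _ = PauliString b := by rw [hU', one_mul, mul_one]
  have hpq : PauliString p.2 = PauliString q.2 ∨ PauliString p.2 = -PauliString q.2 := by
    rw [← key p.2, ← key q.2]
    rcases conj_PauliString_of_mem_Stab hU hp with h1 | h1 <;>
      rcases conj_PauliString_of_mem_Stab hU hq with h2 | h2 <;> rw [h1, h2, h] <;> simp
  have h1 := trace_PauliString_mul p.2 q.2
  have h2 := trace_PauliString_mul q.2 q.2
  rw [if_neg hne] at h1
  rw [if_pos rfl] at h2
  have hD : (2 ^ N : ℂ) ≠ 0 := pow_ne_zero _ two_ne_zero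
  rcases hpq with h3 | h3
  · rw [h3, h2] at h1
    exact hD h1
  · rw [h3, neg_mul, Matrix.trace_neg, h2, neg_eq_zero] at h1
    exact hD h1

/-- A stabilizer pair fixes the commutation sign on the Pauli support of a Heisenberg-evolved
Pauli string. -/
theorem stringSign_eq_of_mem_Stab {N : ℕ} {U : Matrix (Fin N → Fin 2) (Fin N → Fin 2) ℂ}
    (hU : U ∈ Matrix.unitaryGroup (Fin N → Fin 2) ℂ) {p : (Fin N → Fin 4) × (Fin N → Fin 4)}
    (hp : p ∈ Stab U) {a₀ c : Fin N → Fin 4}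
    (hc : (PauliString c * (Uᴴ * PauliString a₀ * U)).trace ≠ 0) :
    stringSign p.1 c = stringSign p.2 a₀ := by
  have hU' : U * Uᴴ = 1 := Matrix.mem_unitaryGroup_iff.mp hU
  set O := Uᴴ * PauliString a₀ * U with hO
  have h1 : PauliString p.1 * O * PauliString p.1 = (stringSign p.2 a₀ : ℂ) • O := by
    have h2 : PauliString p.1 * O * PauliString p.1 =
        (Uᴴ * PauliString p.2 * U) * O * (Uᴴ * PauliString p.2 * U) := by
      rcases conj_PauliString_of_mem_Stab hU hp with h | h <;> rw [h] <;> simp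
    rw [h2, hO]
    calc Uᴴ * PauliString p.2 * U * (Uᴴ * PauliString a₀ * U) * (Uᴴ * PauliString p.2 * U)
        = Uᴴ * PauliString p.2 * (U * Uᴴ) * PauliString a₀ * (U * Uᴴ) * PauliString p.2 * U := by
          noncomm_ring
      _ = Uᴴ * (PauliString p.2 * PauliString a₀ * PauliString p.2) * U := by
          rw [hU']; noncomm_ring
      _ = _ := by rw [PauliString_conj]; simp
  have h3 : (stringSign p.1 c : ℂ) * (PauliString c * O).trace =
      (stringSign p.2 a₀ : ℂ) * (PauliString c * O).trace := by
    calc (stringSign p.1 c : ℂ) * (PauliString c * O).trace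
        = (PauliString p.1 * (PauliString c * PauliString p.1 * O)).trace := by
          rw [← mul_assoc (PauliString p.1), ← mul_assoc (PauliString p.1), PauliString_conj,
            smul_mul_assoc, Matrix.trace_smul, smul_eq_mul]
      _ = (PauliString c * (PauliString p.1 * O * PauliString p.1)).trace := by
          rw [Matrix.trace_mul_comm]; simp only [mul_assoc]
      _ = _ := by rw [h1]; simp
  exact_mod_cast mul_right_cancel₀ hc h3

/-- Uncertainty bound: the stabilizer size times the Pauli support size is at most `4 ^ N`. -/
theorem card_Stab_mul_card_support_le {N : ℕ} {U : Matrix (Fin N → Fin 2) (Fin N → Fin 2) ℂ}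
    (hU : U ∈ Matrix.unitaryGroup (Fin N → Fin 2) ℂ) (a₀ : Fin N → Fin 4)
    (S : Finset (Fin N → Fin 4))
    (hS : ∀ c ∈ S, (PauliString c * (Uᴴ * PauliString a₀ * U)).trace ≠ 0) :
    ((Stab U).card : ℝ) * S.card ≤ 4 ^ N := by
  set G := Stab U
  have h1 : ∑ c ∈ S, (∑ p ∈ G, stringSign p.2 a₀ * stringSign p.1 c) ^ 2 =
      S.card * (G.card : ℝ) ^ 2 := by
    rw [Finset.sum_congr rfl (g := fun _ => (G.card : ℝ) ^ 2)]
    · simp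
    · intro c hc
      rw [Finset.sum_congr rfl (g := fun _ => (1 : ℝ))]
      · simp
      · intro p hp
        rw [stringSign_eq_of_mem_Stab hU hp (hS c hc), stringSign_mul_self]
  have h2 : ∑ c, (∑ p ∈ G, stringSign p.2 a₀ * stringSign p.1 c) ^ 2 = G.card * 4 ^ N := by
    calc ∑ c, (∑ p ∈ G, stringSign p.2 a₀ * stringSign p.1 c) ^ 2
        = ∑ p ∈ G, ∑ q ∈ G, stringSign p.2 a₀ * stringSign q.2 a₀ *
            ∑ c, stringSign p.1 c * stringSign q.1 c := by
          simp only [sq, Finset.sum_mul_sum]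
          rw [Finset.sum_comm]
          refine Finset.sum_congr rfl fun p _ => ?_
          rw [Finset.sum_comm]
          refine Finset.sum_congr rfl fun q _ => ?_
          rw [Finset.mul_sum]
          refine Finset.sum_congr rfl fun c _ => ?_
          ring
      _ = ∑ p ∈ G, (4 : ℝ) ^ N := by
          refine Finset.sum_congr rfl fun p hp => ?_
          rw [Finset.sum_eq_single_of_mem p hp]
          · rw [sum_stringSign_mul, if_pos rfl, stringSign_mul_self, one_mul]
          · intro q hq hne
            rw [sum_stringSign_mul, if_neg, mul_zero]
            exact fun h => hne (injOn_fst_Stab hU hp hq h).symm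
      _ = G.card * 4 ^ N := by simp
  have h3 : S.card * (G.card : ℝ) ^ 2 ≤ G.card * 4 ^ N := by
    rw [← h1, ← h2]
    exact Finset.sum_le_sum_of_subset_of_nonneg (Finset.subset_univ _) fun _ _ _ => sq_nonneg _
  rcases G.card.eq_zero_or_pos with h0 | h0
  · rw [h0]; simp
  · have h0' : (0 : ℝ) < G.card := by exact_mod_cast h0
    refine le_of_mul_le_mul_left ?_ h0'
    linarith

/-- For a Hermitian matrix whose diagonal is supported on `S`, the squared trace is at most `#S`
times the trace of the square. -/
theorem sq_trace_re_le_card_mul {ι : Type*} [Fintype ι] {M : Matrix ι ι ℂ} (hM : Mᴴ = M)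
    (S : Finset ι) (hS : ∀ x ∉ S, M x x = 0) :
    M.trace.re ^ 2 ≤ S.card * (M * M).trace.re := by
  have h1 : M.trace.re = ∑ x ∈ S, (M x x).re := by
    rw [Matrix.trace, Complex.re_sum]
    refine (Finset.sum_subset (Finset.subset_univ S) fun x _ hx => ?_).symm
    simp [hS x hx]
  have h2 : (M * M).trace.re = ∑ x, ∑ y, Complex.normSq (M x y) := by
    simp only [Matrix.trace, Matrix.diag_apply, Matrix.mul_apply, Complex.re_sum]
    refine Finset.sum_congr rfl fun x _ => Finset.sum_congr rfl fun y _ => ?_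
    have h : M y x = star (M x y) := by rw [← Matrix.conjTranspose_apply, hM]
    rw [h, ← starRingEnd_apply, Complex.mul_conj, Complex.ofReal_re]
  have h3 : ∑ x ∈ S, (M x x).re ^ 2 ≤ (M * M).trace.re := by
    rw [h2]
    calc ∑ x ∈ S, (M x x).re ^ 2 ≤ ∑ x, (M x x).re ^ 2 :=
          Finset.sum_le_sum_of_subset_of_nonneg (Finset.subset_univ S) fun _ _ _ => sq_nonneg _
      _ ≤ _ := by
          refine Finset.sum_le_sum fun x _ => ?_
          refine le_trans ?_ (Finset.single_le_sum (f := fun y => Complex.normSq (M x y))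
            (fun y _ => Complex.normSq_nonneg _) (Finset.mem_univ x))
          rw [Complex.normSq_apply]
          nlinarith [mul_self_nonneg (M x x).im]
  rw [h1]
  exact sq_sum_le_card_mul_sum_sq.trans (mul_le_mul_of_nonneg_left h3 (Nat.cast_nonneg _))

/-- The operator-Schmidt realignment of a bipartite matrix. -/
def realign {ιA ιB : Type*} (O : Matrix (ιA × ιB) (ιA × ιB) ℂ) :
    Matrix (ιA × ιA) (ιB × ιB) ℂ :=
  fun p q => O (p.1, q.1) (p.2, q.2)

theorem realign_mul_conjTranspose {ιA ιB : Type*} [Fintype ιA] [Fintype ιB] [Nonempty ιA]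
    [Nonempty ιB] (O : Matrix (ιA × ιB) (ιA × ιB) ℂ) :
    realign O * (realign O)ᴴ = (Fintype.card ιA * Fintype.card ιB : ℂ) • rhoA O := by
  ext p q
  have h : (Fintype.card ιA * Fintype.card ιB : ℂ) ≠ 0 := by simp
  simp only [Matrix.mul_apply, Matrix.conjTranspose_apply, realign, rhoA, Matrix.smul_apply,
    smul_eq_mul, Fintype.sum_prod_type]
  field_simp

theorem trace_realign_mul_conjTranspose {ιA ιB : Type*} [Fintype ιA] [Fintype ιB]
    (O : Matrix (ιA × ιB) (ιA × ιB) ℂ) :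
    (realign O * (realign O)ᴴ).trace = (O * Oᴴ).trace := by
  simp only [Matrix.trace, Matrix.diag_apply, Matrix.mul_apply, Matrix.conjTranspose_apply,
    realign, Fintype.sum_prod_type]
  refine Finset.sum_congr rfl fun i _ => ?_
  rw [Finset.sum_comm]

theorem PauliString_append (NA NB : ℕ) (x : Fin NA → Fin 4) (y : Fin NB → Fin 4)
    (p q : (Fin NA → Fin 2) × (Fin NB → Fin 2)) :
    PauliString (Fin.append x y) ((qubitEquiv NA NB).symm p) ((qubitEquiv NA NB).symm q) =
      PauliString x p.1 q.1 * PauliString y p.2 q.2 := by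
  simp [PauliString, Fin.prod_univ_add, qubitEquiv, Equiv.sumArrowEquivProdArrow]

/-- The Pauli coefficients of a bipartite operator, arranged by subsystem labels. -/
theorem pauliBasis_mul_realign_mul (NA NB : ℕ)
    (O : Matrix (Fin (NA + NB) → Fin 2) (Fin (NA + NB) → Fin 2) ℂ)
    (x : Fin NA → Fin 4) (y : Fin NB → Fin 4) :
    (pauliBasis NA * realign (Matrix.reindex (qubitEquiv NA NB) (qubitEquiv NA NB) O) *
      (pauliBasis NB)ᵀ) x y = (PauliString (Fin.append x y) * O).trace := by
  have h : (PauliString (Fin.append x y) * O).trace =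
      ∑ p, ∑ q, PauliString x p.1 q.1 * PauliString y p.2 q.2 *
        O ((qubitEquiv NA NB).symm q) ((qubitEquiv NA NB).symm p) := by
    simp only [Matrix.trace, Matrix.diag_apply, Matrix.mul_apply]
    rw [← (qubitEquiv NA NB).symm.sum_comp]
    refine Finset.sum_congr rfl fun p _ => ?_
    rw [← (qubitEquiv NA NB).symm.sum_comp]
    simp only [PauliString_append]
  rw [h]
  simp only [Matrix.mul_apply, Matrix.transpose_apply, pauliBasis, realign, Matrix.reindex_apply,
    Matrix.submatrix_apply, Finset.sum_mul, ← Finset.sum_product', Finset.univ_product_univ]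
  refine Fintype.sum_equiv
    ⟨fun t => ((t.2.2, t.1.2), (t.2.1, t.1.1)), fun t => ((t.2.2, t.1.2), (t.2.1, t.1.1)),
      fun _ => rfl, fun _ => rfl⟩ _ _ fun t => ?_
  simp only [Equiv.coe_fn_mk]
  ring

/-- The purity of the reduced Choi state of a unitary operator is at least the inverse of the
size of its Pauli support. -/
theorem one_le_card_support_mul_purity (NA NB : ℕ)
    (O : Matrix (Fin (NA + NB) → Fin 2) (Fin (NA + NB) → Fin 2) ℂ) (hO : O * Oᴴ = 1)
    (S : Finset (Fin (NA + NB) → Fin 4)) (hS : ∀ c ∉ S, (PauliString c * O).trace = 0) :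
    1 ≤ (S.card : ℝ) * (rhoAq NA NB O * rhoAq NA NB O).trace.re := by
  set e := qubitEquiv NA NB
  set R := realign (Matrix.reindex e e O) with hR
  set V := pauliBasis NA
  set W := pauliBasis NB
  set ρ := rhoAq NA NB O with hρ
  set d : ℝ := 2 ^ NA * 2 ^ NB with hd
  have hd0 : 0 < d := by positivity
  have hRR : R * Rᴴ = (d : ℂ) • ρ := by
    rw [hR, realign_mul_conjTranspose, hρ, rhoAq, hd]
    simp [e]
  have hV : Vᴴ * V = (2 ^ NA : ℂ) • 1 := by
    convert conjTranspose_pauliBasis_mul NA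
  have hW : Wᵀ * Wᵀᴴ = (2 ^ NB : ℂ) • 1 := by
    have h : Wᵀ * Wᵀᴴ = (Wᴴ * W)ᵀ := by
      rw [Matrix.transpose_mul]; rfl
    rw [h, conjTranspose_pauliBasis_mul, Matrix.transpose_smul, Matrix.transpose_one]
  have htr : ρ.trace = 1 := by
    have h1 : (R * Rᴴ).trace = d := by
      rw [hR, trace_realign_mul_conjTranspose, Matrix.conjTranspose_reindex]
      simp only [Matrix.reindex_apply, Matrix.submatrix_mul_equiv, hO, Matrix.submatrix_one_equiv,
        Matrix.trace_one]
      simp [hd]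
    rw [hRR, Matrix.trace_smul, smul_eq_mul] at h1
    exact mul_left_cancel₀ (Complex.ofReal_ne_zero.mpr hd0.ne') (h1.trans (mul_one _).symm)
  set C := V * R * Wᵀ with hC
  set M := C * Cᴴ with hM
  have hMρ : M = (2 ^ NB * d : ℂ) • (V * ρ * Vᴴ) := by
    calc M = V * R * (Wᵀ * Wᵀᴴ) * Rᴴ * Vᴴ := by
          simp only [hM, hC, Matrix.conjTranspose_mul, Matrix.mul_assoc]
      _ = (2 ^ NB : ℂ) • (V * (R * Rᴴ) * Vᴴ) := by
          rw [hW]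
          simp [Matrix.mul_assoc]
      _ = _ := by
          rw [hRR, Matrix.mul_smul, Matrix.smul_mul, smul_smul]
  have hMtr : M.trace = ((d ^ 2 : ℝ) : ℂ) := by
    rw [hMρ, Matrix.trace_smul, Matrix.trace_mul_cycle, hV]
    simp only [Matrix.smul_mul, Matrix.one_mul, Matrix.trace_smul, htr, hd, smul_eq_mul]
    push_cast
    ring
  have hMMtr : (M * M).trace = ((d ^ 4 : ℝ) : ℂ) * (ρ * ρ).trace := by
    have h : V * ρ * Vᴴ * (V * ρ * Vᴴ) = (2 ^ NA : ℂ) • (V * (ρ * ρ) * Vᴴ) := by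
      calc V * ρ * Vᴴ * (V * ρ * Vᴴ) = V * ρ * (Vᴴ * V) * ρ * Vᴴ := by
            simp only [Matrix.mul_assoc]
        _ = _ := by
            rw [hV]
            simp [Matrix.mul_assoc]
    rw [hMρ, Matrix.smul_mul, Matrix.mul_smul, h]
    simp only [Matrix.trace_smul, smul_eq_mul]
    rw [Matrix.trace_mul_cycle, hV]
    simp only [Matrix.smul_mul, Matrix.one_mul, Matrix.trace_smul, hd, smul_eq_mul]
    push_cast
    ring
  set T : Finset (Fin NA → Fin 4) := S.image fun c k => c (Fin.castAdd NB k) with hT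
  have hMT : ∀ x ∉ T, M x x = 0 := by
    intro x hx
    rw [hM, Matrix.mul_apply]
    refine Finset.sum_eq_zero fun y _ => ?_
    rw [hC, pauliBasis_mul_realign_mul, hS, zero_mul]
    intro hmem
    refine hx (Finset.mem_image.mpr ⟨_, hmem, ?_⟩)
    ext k
    simp
  have key := sq_trace_re_le_card_mul (by simp [hM] : Mᴴ = M) T hMT
  rw [hMtr, hMMtr, Complex.ofReal_re, Complex.re_ofReal_mul] at key
  have hd4 : 0 < d ^ 4 := by positivity
  have h1 : 1 ≤ (T.card : ℝ) * (ρ * ρ).trace.re := by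
    refine le_of_mul_le_mul_left ?_ hd4
    linarith
  have hTS : (T.card : ℝ) ≤ S.card := by exact_mod_cast Finset.card_image_le
  have hpos : 0 ≤ (ρ * ρ).trace.re := by
    by_contra! hneg
    nlinarith [(Nat.cast_nonneg T.card : (0 : ℝ) ≤ T.card)]
  exact h1.trans (mul_le_mul_of_nonneg_right hTS hpos)

/-- `α = 2` instance of Theorem 2's chain
`E_A^{(α)}(O_U) ≤ ν(U)`: the purity of the reduced Choi state of a
Heisenberg-evolved Pauli string is at least `|Stab(U)| / 4^N`. -/
theorem loe_purity_ge_stab_card (NA NB : ℕ)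
    (U : Matrix (Fin (NA + NB) → Fin 2) (Fin (NA + NB) → Fin 2) ℂ)
    (hU : U ∈ Matrix.unitaryGroup (Fin (NA + NB) → Fin 2) ℂ)
    (a₀ : Fin (NA + NB) → Fin 4) :
    ((Stab U).card : ℝ) / (4 ^ (NA + NB) : ℝ) ≤
      (Matrix.trace (rhoAq NA NB (Uᴴ * PauliString a₀ * U) *
          rhoAq NA NB (Uᴴ * PauliString a₀ * U))).re := by
  have hU' : U * Uᴴ = 1 := Matrix.mem_unitaryGroup_iff.mp hU
  have hU'' : Uᴴ * U = 1 := Matrix.mem_unitaryGroup_iff'.mp hU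
  set O := Uᴴ * PauliString a₀ * U with hO
  have hOO : O * Oᴴ = 1 := by
    calc O * Oᴴ = Uᴴ * PauliString a₀ * (U * Uᴴ) * PauliString a₀ * U := by
          simp only [hO, Matrix.conjTranspose_mul, conjTranspose_PauliString,
            Matrix.conjTranspose_conjTranspose, Matrix.mul_assoc]
      _ = Uᴴ * (PauliString a₀ * PauliString a₀) * U := by rw [hU']; noncomm_ring
      _ = 1 := by rw [PauliString_mul_self, mul_one, hU'']
  set S := Finset.univ.filter fun c => (PauliString c * O).trace ≠ 0 with hS
  have h1 := one_le_card_support_mul_purity NA NB O (by convert hOO) S (by simp [hS])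
  have h2 := card_Stab_mul_card_support_le hU a₀ S (by simp [hS, hO])
  set P := (rhoAq NA NB O * rhoAq NA NB O).trace.re
  have hP : 0 ≤ P := by
    by_contra! hneg
    nlinarith [(Nat.cast_nonneg S.card : (0 : ℝ) ≤ S.card)]
  rw [div_le_iff₀ (by positivity)]
  calc ((Stab U).card : ℝ) ≤ (Stab U).card * (S.card * P) :=
        le_mul_of_one_le_right (Nat.cast_nonneg _) h1
    _ = (Stab U).card * S.card * P := by ring
    _ ≤ 4 ^ (NA + NB) * P := mul_le_mul_of_nonneg_right h2 hP
    _ = P * 4 ^ (NA + NB) := mul_comm _ _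

end
end

section
/- (Lemma 2, first identity.) Let N ≥ 1, θ : ℝ, and let K be the single-qubit phase gate on the first qubit: the diagonal matrix on (Fin N → Fin 2) with K f f = Complex.exp (θ * I) if f 0 = 1 and K f f = 1 otherwise (i.e. K = P_θ ⊗ 1 with P_θ = diag(1, e^{iθ})). Then for every σ : Equiv.Perm (Fin 4), tr(K^{⊗4} * Λ⁺ * (Kᴴ)^{⊗4} * T_σ) = D^(#(σ) − 2·δ(σ)). -/
open Matrix Kronecker
open scoped Classical

noncomputable section

theorem replica_mul_replica {ι : Type*} [Fintype ι] {n : ℕ} (A B : Matrix ι ι ℂ) :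
    replica n A * replica n B = replica n (A * B) := by
  ext f g
  simp only [replica, Matrix.mul_apply, Finset.prod_univ_sum, Fintype.piFinset_univ,
    Finset.prod_mul_distrib]

theorem replica_one {ι : Type*} [DecidableEq ι] {n : ℕ} :
    replica n (1 : Matrix ι ι ℂ) = 1 := by
  ext f g
  simp only [replica, Matrix.one_apply, Finset.prod_ite_zero, Finset.prod_const_one,
    Finset.mem_univ, true_imp_iff, funext_iff]

theorem mul_Tperm_apply {ι : Type*} [Fintype ι] [DecidableEq ι] {n : ℕ}
    (M : Matrix (Fin n → ι) (Fin n → ι) ℂ) (σ : Equiv.Perm (Fin n)) (f g : Fin n → ι) :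
    (M * Tperm σ : Matrix (Fin n → ι) (Fin n → ι) ℂ) f g = M f (g ∘ σ) := by
  simp [Matrix.mul_apply, Tperm]

theorem Tperm_mul_apply {ι : Type*} [Fintype ι] [DecidableEq ι] {n : ℕ}
    (M : Matrix (Fin n → ι) (Fin n → ι) ℂ) (σ : Equiv.Perm (Fin n)) (f g : Fin n → ι) :
    (Tperm σ * M : Matrix (Fin n → ι) (Fin n → ι) ℂ) f g = M (f ∘ σ.symm) g := by
  have h (x : Fin n → ι) : f = x ∘ σ ↔ f ∘ σ.symm = x := (Equiv.comp_symm_eq σ x f).symm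
  simp [Matrix.mul_apply, Tperm, h]

/-- Replicas of an operator commute with permutations of the replicas. -/
theorem replica_mul_Tperm {ι : Type*} [Fintype ι] [DecidableEq ι] {n : ℕ}
    (O : Matrix ι ι ℂ) (σ : Equiv.Perm (Fin n)) :
    replica n O * Tperm σ = Tperm σ * replica n O := by
  ext f g
  rw [mul_Tperm_apply, Tperm_mul_apply]
  simp only [replica]
  rw [← Equiv.prod_comp σ (fun a => O ((f ∘ σ.symm) a) (g a))]
  simp

/-- Unitary conjugation of the replicas does not affect traces against replica permutations. -/
theorem trace_replica_conj_mul_Tperm {ι : Type*} [Fintype ι] [DecidableEq ι] {n : ℕ}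
    {U : Matrix ι ι ℂ} (hU : Uᴴ * U = 1) (M : Matrix (Fin n → ι) (Fin n → ι) ℂ)
    (σ : Equiv.Perm (Fin n)) :
    Matrix.trace (replica n U * M * replica n Uᴴ * Tperm σ) = Matrix.trace (M * Tperm σ) := by
  rw [Matrix.mul_assoc _ (replica n Uᴴ), replica_mul_Tperm, ← Matrix.mul_assoc,
    Matrix.trace_mul_comm, Matrix.mul_assoc (replica n U), ← Matrix.mul_assoc,
    replica_mul_replica, hU, replica_one, Matrix.one_mul]

/-- The traces of replicated Pauli strings factorize over the qubits. -/
theorem sum_trace_replica_PauliString_mul_Tperm (N n : ℕ) (σ : Equiv.Perm (Fin n)) :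
    ∑ a : Fin N → Fin 4, Matrix.trace (replica n (PauliString a) * Tperm σ) =
      (∑ p : Fin 4, ∑ x : Fin n → Fin 2, ∏ i, pauli p (x i) (x (σ i))) ^ N := by
  have key (a : Fin N → Fin 4) :
      Matrix.trace (replica n (PauliString a) * Tperm σ) =
        ∏ k, ∑ x : Fin n → Fin 2, ∏ i, pauli (a k) (x i) (x (σ i)) := by
    simp only [Matrix.trace, Matrix.diag_apply, mul_Tperm_apply, replica, PauliString,
      Finset.prod_univ_sum, Fintype.piFinset_univ]
    refine Fintype.sum_equiv (Equiv.piComm fun _ _ => Fin 2) _ _ fun f => ?_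
    rw [Finset.prod_comm]
    rfl
  simp only [key]
  rw [← Fin.prod_const, Finset.prod_univ_sum, Fintype.piFinset_univ]

/-- The Pauli matrices over the Gaussian integers, where identities can be decided. -/
def pauliGauss : Fin 4 → Matrix (Fin 2) (Fin 2) GaussianInt :=
  ![1, !![0, 1; 1, 0], !![0, ⟨0, -1⟩; ⟨0, 1⟩, 0], !![1, 0; 0, -1]]

theorem toComplex_pauliGauss (p : Fin 4) (i j : Fin 2) :
    GaussianInt.toComplex (pauliGauss p i j) = pauli p i j := by
  fin_cases p <;> fin_cases i <;> fin_cases j <;>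
    simp [pauliGauss, pauli, GaussianInt.toComplex_def]

theorem sum_prod_pauliGauss (σ : Equiv.Perm (Fin 4)) :
    ∑ p : Fin 4, ∑ x : Fin 4 → Fin 2, ∏ i, pauliGauss p (x i) (x (σ i)) =
      4 * 2 ^ (numCycles σ - 2 * deltaOdd σ) := by
  revert σ
  decide +kernel

theorem sum_prod_pauli (σ : Equiv.Perm (Fin 4)) :
    ∑ p : Fin 4, ∑ x : Fin 4 → Fin 2, ∏ i, pauli p (x i) (x (σ i)) =
      4 * 2 ^ (numCycles σ - 2 * deltaOdd σ) := by
  simpa only [map_sum, map_prod, map_mul, map_pow, map_ofNat, toComplex_pauliGauss] using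
    congrArg GaussianInt.toComplex (sum_prod_pauliGauss σ)

/-- Lemma 2, first identity: the phase gate on the first qubit
leaves the `Λ⁺`-contracted replica permutation traces invariant. -/
theorem lemma_two_first (N : ℕ) (hN : 1 ≤ N) (θ : ℝ)
    (K : Matrix (Fin N → Fin 2) (Fin N → Fin 2) ℂ)
    (hK : K = Matrix.diagonal fun f =>
      if f ⟨0, hN⟩ = 1 then Complex.exp (θ * Complex.I) else 1)
    (σ : Equiv.Perm (Fin 4)) :
    Matrix.trace (replica 4 K * LambdaPlus N * replica 4 Kᴴ * Tperm σ) =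
      (2 ^ N : ℂ) ^ (numCycles σ - 2 * deltaOdd σ) := by
  have hU : Kᴴ * K = 1 := by
    rw [hK, Matrix.diagonal_conjTranspose, Matrix.diagonal_mul_diagonal, Matrix.diagonal_eq_one]
    funext f
    by_cases hf : f ⟨0, hN⟩ = 1
    · simp [hf, ← Complex.exp_conj, ← Complex.exp_add]
    · simp [hf]
  rw [trace_replica_conj_mul_Tperm hU, LambdaPlus, Matrix.smul_mul, Finset.sum_mul,
    Matrix.trace_smul, Matrix.trace_sum, sum_trace_replica_PauliString_mul_Tperm,
    sum_prod_pauli, smul_eq_mul, mul_pow, ← pow_mul, ← pow_mul, mul_comm N]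
  field_simp

end
end

section
/- (Replica permutation trace identity used throughout the Weingarten computations.) Let ι be a finite type, O a matrix on ι, n : ℕ, and π : Equiv.Perm (Fin n). Then tr(O^{⊗n} * T_π) = (∏_{k ∈ π.cycleType} tr(O^k)) · (tr O)^{f(π)}, where the product runs over the multiset of nontrivial cycle lengths of π and f(π) is the number of fixed points of π; i.e., the replica trace against a permutation operator factorizes into power traces over the cycles of the permutation. -/
open Matrix Kronecker
open scoped Classical

noncomputable section

/-- The sum over all colourings `f` of the sites of a permutation `σ` of the product of the
matrix entries of `O` along the arrows `a ↦ σ a`. -/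
def permContraction {ι α R : Type*} [Fintype ι] [Fintype α] [DecidableEq α] [CommSemiring R]
    (O : Matrix ι ι R) (σ : Equiv.Perm α) : R :=
  ∑ f : α → ι, ∏ a, O (f a) (f (σ a))

section PermContraction

variable {ι α β R : Type*} [Fintype ι] [Fintype α] [DecidableEq α] [Fintype β] [DecidableEq β]
  [CommSemiring R] (O : Matrix ι ι R)

theorem permContraction_congr (e : α ≃ β) {σ : Equiv.Perm α} {τ : Equiv.Perm β}
    (h : ∀ a, e (σ a) = τ (e a)) : permContraction O σ = permContraction O τ := by
  unfold permContraction
  refine Fintype.sum_equiv (e.arrowCongr (Equiv.refl ι)) _ _ fun f => ?_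
  refine Fintype.prod_equiv e _ _ fun a => ?_
  simp [← h]

theorem permContraction_sumCongr (σ : Equiv.Perm α) (τ : Equiv.Perm β) :
    permContraction O (σ.sumCongr τ) = permContraction O σ * permContraction O τ := by
  unfold permContraction
  rw [Finset.sum_mul_sum, ← Fintype.sum_prod_type']
  refine Fintype.sum_equiv (Equiv.sumArrowEquivProdArrow α β ι) _ _ fun f => ?_
  simp [Fintype.prod_sum_type, Equiv.sumArrowEquivProdArrow]

theorem permContraction_one :
    permContraction O (1 : Equiv.Perm α) = O.trace ^ Fintype.card α := by
  simp only [permContraction, Equiv.Perm.one_apply, Matrix.trace, Matrix.diag_apply]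
  rw [← Fintype.prod_sum fun (_ : α) i => O i i]
  simp

theorem sum_prod_path_mul [DecidableEq ι] (m : ℕ) (w : ι → ι → R) :
    ∑ f : Fin (m + 1) → ι, (∏ i : Fin m, O (f i.castSucc) (f i.succ)) * w (f 0) (f (Fin.last m)) =
      ∑ a, ∑ b, (O ^ m) a b * w a b := by
  induction m generalizing w with
  | zero =>
    rw [Fintype.sum_equiv (Equiv.funUnique (Fin 1) ι) _ (fun a => w a a)
      (fun f => by simp [Equiv.funUnique])]
    simp [Matrix.one_apply]
  | succ m ih =>
    rw [← (Fin.consEquiv fun _ : Fin (m + 2) => ι).sum_comp, Fintype.sum_prod_type]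
    refine Finset.sum_congr rfl fun x _ => ?_
    have key := ih fun a b => O x a * w x b
    calc _ = _ := Finset.sum_congr rfl fun g _ => ?_
      _ = _ := key
      _ = _ := ?_
    · simp only [Fin.consEquiv_apply, Fin.prod_univ_succ, Fin.castSucc_zero, Fin.cons_zero,
        Fin.cons_succ, ← Fin.succ_last, Fin.castSucc_succ]
      ring
    · rw [Finset.sum_comm]
      refine Finset.sum_congr rfl fun b _ => ?_
      rw [pow_succ', Matrix.mul_apply, Finset.sum_mul]
      exact Finset.sum_congr rfl fun a _ => by ring

theorem permContraction_finRotate [DecidableEq ι] (m : ℕ) :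
    permContraction O (finRotate (m + 1)) = (O ^ (m + 1)).trace := by
  simp only [permContraction, Fin.prod_univ_castSucc, finRotate_apply,
    Fin.coeSucc_eq_succ, Fin.last_add_one]
  rw [sum_prod_path_mul O m fun a b => O b a]
  simp [pow_succ, Matrix.trace, Matrix.mul_apply]

/-- The restriction of a permutation to its support. -/
def Equiv.Perm.restrictSupport (σ : Equiv.Perm α) : Equiv.Perm σ.support :=
  σ.subtypePerm fun _ => Equiv.Perm.apply_mem_support

theorem Equiv.Perm.IsCycle.permContraction_restrictSupport [DecidableEq ι] {σ : Equiv.Perm α}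
    (hσ : σ.IsCycle) : permContraction O σ.restrictSupport = (O ^ σ.support.card).trace := by
  obtain ⟨m, hm⟩ : ∃ m, orderOf σ = m + 1 := Nat.exists_eq_add_one.2 (orderOf_pos σ)
  rw [← hσ.orderOf, hm, ← permContraction_finRotate]
  let e : Fin (m + 1) ≃ σ.support :=
    (finCongr hm.symm).trans ((finEquivZPowers (isOfFinOrder_of_finite σ)).trans
      hσ.zpowersEquivSupport)
  have he (i : Fin (m + 1)) : (e i : α) = (σ ^ (i : ℕ)) (Classical.choose hσ) := by
    simp [e]; rfl
  refine (permContraction_congr O e fun i => Subtype.ext ?_).symm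
  change _ = σ (e i)
  rw [he, he, ← Equiv.Perm.mul_apply, ← pow_succ']
  congr 1
  rw [finRotate_apply, Fin.val_add_one]
  split_ifs with h
  · rw [h, Fin.val_last, ← hm, pow_orderOf_eq_one, pow_zero]
  · rfl

theorem Equiv.Perm.Disjoint.permContraction_restrictSupport_mul {σ τ : Equiv.Perm α}
    (h : σ.Disjoint τ) : permContraction O (σ * τ).restrictSupport =
      permContraction O σ.restrictSupport * permContraction O τ.restrictSupport := by
  rw [← permContraction_sumCongr]
  let e : σ.support ⊕ τ.support ≃ (σ * τ).support :=
    (Equiv.Finset.union _ _ h.disjoint_support).trans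
      (Equiv.subtypeEquivRight fun x => by rw [h.support_mul])
  refine (permContraction_congr O e ?_).symm
  rintro (⟨a, ha⟩ | ⟨a, ha⟩)
  · refine Subtype.ext ?_
    change σ a = σ (τ a)
    rw [(h a).resolve_left (Equiv.Perm.mem_support.1 ha)]
  · refine Subtype.ext ?_
    change τ a = (σ * τ) a
    rw [h.commute.eq, Equiv.Perm.mul_apply, (h a).resolve_right (Equiv.Perm.mem_support.1 ha)]

theorem permContraction_restrictSupport [DecidableEq ι] (σ : Equiv.Perm α) :
    permContraction O σ.restrictSupport = (σ.cycleType.map fun k => (O ^ k).trace).prod := by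
  induction σ using Equiv.Perm.cycle_induction_on with
  | base_one =>
    have : IsEmpty (1 : Equiv.Perm α).support := by simp [isEmpty_subtype]
    simp [permContraction]
  | base_cycles σ hσ => simp [hσ.permContraction_restrictSupport, hσ.cycleType]
  | induction_disjoint σ τ h _ ihσ ihτ =>
    rw [h.permContraction_restrictSupport_mul, ihσ, ihτ, h.cycleType_mul, Multiset.map_add,
      Multiset.prod_add]

theorem permContraction_eq [DecidableEq ι] (σ : Equiv.Perm α) :
    permContraction O σ = (σ.cycleType.map fun k => (O ^ k).trace).prod *
      O.trace ^ (Finset.univ.filter fun x => σ x = x).card := by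
  have hcard : (Finset.univ.filter fun x => σ x = x).card =
      Fintype.card {x // x ∉ σ.support} := by
    simp [Fintype.card_subtype]
  rw [← permContraction_restrictSupport, hcard, ← permContraction_one, ← permContraction_sumCongr]
  refine (permContraction_congr O (Equiv.sumCompl (· ∈ σ.support)) ?_).symm
  rintro (⟨a, ha⟩ | ⟨a, ha⟩)
  · rfl
  · exact (Equiv.Perm.notMem_support.1 ha).symm

end PermContraction

theorem trace_replica_mul_Tperm {ι : Type*} [Fintype ι] [DecidableEq ι] {n : ℕ}
    (O : Matrix ι ι ℂ) (π : Equiv.Perm (Fin n)) :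
    (replica n O * Tperm π).trace = permContraction O π := by
  simp [permContraction, Matrix.trace, Matrix.mul_apply, replica, Tperm]

/-- the replica trace against a permutation operator factorizes
into power traces over the cycles of the permutation. -/
theorem replica_trace_factorizes {ι : Type*} [Fintype ι] [DecidableEq ι]
    (O : Matrix ι ι ℂ) (n : ℕ) (π : Equiv.Perm (Fin n)) :
    Matrix.trace (replica n O * Tperm π) =
      (π.cycleType.map fun k => Matrix.trace (O ^ k)).prod *
        Matrix.trace O ^ (Finset.univ.filter fun x => π x = x).card := by
  rw [trace_replica_mul_Tperm, permContraction_eq]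

end
end
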